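/- Let F : ℝ^d × ℝ → ℝ be continuous, continuously differentiable in its second variable, with ∂_s F continuous and bounded on ℝ^d × ℝ. Let μ, μ' be compactly supported Borel probability measures on ℝ^d and, for s ∈ [0,1], set μ_s := (1−s)μ + sμ'. Then for every ε > 0 and every x ∈ ℝ^d, F^ε(x, μ') − F^ε(x, μ) = ∫₀¹ ( ∫_{ℝ^d} K_s(x,z) dμ'(z) − ∫_{ℝ^d} K_s(x,z) dμ(z) ) ds, where K_s(x,z) := ∫_{ℝ^d} ξ^ε(y−z) ∂_s F(y, (ξ^ε ⋆ μ_s)(y)) ξ^ε(x−y) dy. -/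

import Mathlib

open MeasureTheory

noncomputable section

/-- Euclidean space `ℝ^d`. -/
abbrev Euc (d : ℕ) := EuclideanSpace ℝ (Fin d)

/-- The scaled mollifier `ξ^ε(x) = ε^{-d} ξ(x/ε)`. -/
def sMoll (d : ℕ) (ξ : Euc d → ℝ) (ε : ℝ) : Euc d → ℝ :=
  fun x => (ε ^ d)⁻¹ * ξ (ε⁻¹ • x)

/-- Convolution `(ξ^ε ⋆ μ)(y) = ∫ ξ^ε(y−z) dμ(z)` of the scaled mollifier with a measure. -/
def mollMeas (d : ℕ) (ξ : Euc d → ℝ) (ε : ℝ) (μ : Measure (Euc d)) : Euc d → ℝ :=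
  fun y => ∫ z, sMoll d ξ ε (y - z) ∂μ

/-- The mollified coupling `F^ε(x, μ) = ∫ ξ^ε(x−y) F(y, (ξ^ε ⋆ μ)(y)) dy`. -/
def FepsMeas (d : ℕ) (ξ : Euc d → ℝ) (ε : ℝ) (F : Euc d → ℝ → ℝ)
    (μ : Measure (Euc d)) : Euc d → ℝ :=
  fun x => ∫ y, sMoll d ξ ε (x - y) * F y (mollMeas d ξ ε μ y)

/-- The interpolation measure $μ_s = (1−s)μ + sμ'$. -/
def interpMeas (d : ℕ) (μ μ' : Measure (Euc d)) (s : ℝ) : Measure (Euc d) :=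
  ENNReal.ofReal (1 - s) • μ + ENNReal.ofReal s • μ'

/-- The kernel $K_s(x,z) = ∫ ξ^ε(y−z) ∂_s F(y,(ξ^ε⋆μ_s)(y)) ξ^ε(x−y) dy$. -/
def Kker (d : ℕ) (ξ : Euc d → ℝ) (ε : ℝ) (F' : Euc d → ℝ → ℝ)
    (μ μ' : Measure (Euc d)) (s : ℝ) : Euc d → Euc d → ℝ :=
  fun x z => ∫ y, sMoll d ξ ε (y - z) * F' y (mollMeas d ξ ε (interpMeas d μ μ' s) y)
    * sMoll d ξ ε (x - y)

/-- The scaled mollifier is continuous. -/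
theorem continuous_sMoll {d : ℕ} {ξ : Euc d → ℝ} (hξ : Continuous ξ) (ε : ℝ) :
    Continuous (sMoll d ξ ε) := by
  unfold sMoll
  fun_prop

/-- The scaled mollifier has compact support. -/
theorem hasCompactSupport_sMoll {d : ℕ} {ξ : Euc d → ℝ} (hξ : HasCompactSupport ξ) {ε : ℝ}
    (hε : ε ≠ 0) : HasCompactSupport (sMoll d ξ ε) :=
  (hξ.comp_smul (inv_ne_zero hε)).mul_left

/-- The reflected translate `y ↦ g (x - y)` of a compactly supported function has compact
support. -/
theorem hasCompactSupport_comp_sub_left {d : ℕ} {g : Euc d → ℝ} (hg : HasCompactSupport g)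
    (x : Euc d) : HasCompactSupport fun y => g (x - y) :=
  hg.comp_homeomorph (Homeomorph.subLeft x)

/-- The mollification of a finite measure by a bounded continuous mollifier is continuous. -/
theorem continuous_mollMeas {d : ℕ} {ξ : Euc d → ℝ} {ε C : ℝ}
    (hc : Continuous (sMoll d ξ ε)) (hC : ∀ y, ‖sMoll d ξ ε y‖ ≤ C)
    (ν : Measure (Euc d)) [IsFiniteMeasure ν] : Continuous (mollMeas d ξ ε ν) := by
  refine continuous_of_dominated (bound := fun _ => C) ?_ ?_ (integrable_const C) ?_
  · intro y
    exact (by fun_prop : Continuous fun z => sMoll d ξ ε (y - z)).aestronglyMeasurable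
  · exact fun y => .of_forall fun z => hC _
  · exact .of_forall fun z => by fun_prop

/-- The mollification is affine along the interpolation of two finite measures. -/
theorem mollMeas_interpMeas {d : ℕ} {ξ : Euc d → ℝ} {ε C : ℝ}
    (hc : Continuous (sMoll d ξ ε)) (hC : ∀ y, ‖sMoll d ξ ε y‖ ≤ C)
    (μ μ' : Measure (Euc d)) [IsFiniteMeasure μ] [IsFiniteMeasure μ']
    {s : ℝ} (h0 : 0 ≤ s) (h1 : s ≤ 1) (y : Euc d) :
    mollMeas d ξ ε (interpMeas d μ μ' s) y
      = (1 - s) * mollMeas d ξ ε μ y + s * mollMeas d ξ ε μ' y := by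
  have hi (ν : Measure (Euc d)) [IsFiniteMeasure ν] :
      Integrable (fun z => sMoll d ξ ε (y - z)) ν :=
    .of_bound (by fun_prop : Continuous fun z => sMoll d ξ ε (y - z)).aestronglyMeasurable C
      (.of_forall fun z => hC _)
  unfold mollMeas interpMeas
  rw [integral_add_measure ((hi μ).smul_measure ENNReal.ofReal_ne_top)
    ((hi μ').smul_measure ENNReal.ofReal_ne_top), integral_smul_measure, integral_smul_measure,
    ENNReal.toReal_ofReal (sub_nonneg.2 h1), ENNReal.toReal_ofReal h0, smul_eq_mul, smul_eq_mul]

/-- A continuous function on a product, dominated by an integrable function of the second variable,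
is integrable when the first factor has finite measure. -/
theorem integrable_prod_of_norm_le_snd {X Y : Type*} [TopologicalSpace X]
    [SecondCountableTopology X] [MeasurableSpace X] [BorelSpace X] [TopologicalSpace Y]
    [SecondCountableTopology Y] [MeasurableSpace Y] [BorelSpace Y]
    {ν : Measure X} [IsFiniteMeasure ν] {ρ : Measure Y} [SFinite ρ] {f : X × Y → ℝ} {g : Y → ℝ}
    (hf : Continuous f) (hg : Integrable g ρ) (hfg : ∀ p, ‖f p‖ ≤ g p.2) :
    Integrable f (ν.prod ρ) :=
  (hg.comp_snd ν).mono' hf.aestronglyMeasurable (.of_forall hfg)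

/-- Integrating the kernel against a finite measure replaces the mollifier by the mollification of
that measure. -/
theorem integral_mollifier_kernel {d : ℕ} {ξ : Euc d → ℝ} {ε C M : ℝ}
    (hc : Continuous (sMoll d ξ ε)) (hC : ∀ y, ‖sMoll d ξ ε y‖ ≤ C)
    (ν : Measure (Euc d)) [IsFiniteMeasure ν] {b k : Euc d → ℝ}
    (hb : Continuous b) (hM : ∀ y, |b y| ≤ M) (hk : Continuous k) (hki : Integrable k) :
    ∫ z, (∫ y, sMoll d ξ ε (y - z) * b y * k y) ∂ν
      = ∫ y, mollMeas d ξ ε ν y * b y * k y := by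
  rw [integral_integral_swap]
  · simp only [mollMeas, integral_mul_const]
  · refine integrable_prod_of_norm_le_snd (g := fun y => C * M * ‖k y‖) ?_
      (hki.norm.const_mul _) fun p => ?_
    · unfold Function.uncurry
      fun_prop
    · simp only [Function.uncurry, norm_mul]
      have := hC (p.2 - p.1)
      have := hM p.2
      rw [Real.norm_eq_abs (b p.2)]
      have : 0 ≤ C := (norm_nonneg _).trans (hC 0)
      gcongr

/-- Fundamental theorem of calculus along the segment from `a` to `b`. -/
theorem integral_mul_deriv_segment {f f' : ℝ → ℝ} (hf : ∀ r, HasDerivAt f (f' r) r)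
    (hf' : Continuous f') (a b : ℝ) :
    ∫ s in (0 : ℝ)..1, (b - a) * f' ((1 - s) * a + s * b) = f b - f a := by
  have h (s : ℝ) : HasDerivAt (fun s => f ((1 - s) * a + s * b))
      ((b - a) * f' ((1 - s) * a + s * b)) s := by
    have h1 : HasDerivAt (fun s : ℝ => (1 - s) * a + s * b) (b - a) s := by
      have h2 := (((hasDerivAt_id' s).const_sub 1).mul_const a).add
        ((hasDerivAt_id' s).mul_const b)
      rwa [show -1 * a + 1 * b = b - a by ring] at h2
    rw [mul_comm]
    exact (hf _).comp s h1
  rw [intervalIntegral.integral_eq_sub_of_hasDerivAt (fun s _ => h s)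
    (Continuous.intervalIntegrable (by fun_prop) _ _)]
  simp

/-- First-order expansion (flat derivative formula) of $μ ↦ F^ε(x,μ)$. -/
theorem statement5 (d : ℕ) (hd : 1 ≤ d) (ξ : Euc d → ℝ)
    (hξ_smooth : ContDiff ℝ (⊤ : ℕ∞) ξ) (hξ_nonneg : ∀ x, 0 ≤ ξ x)
    (hξ_even : ∀ x, ξ (-x) = ξ x) (hξ_supp : HasCompactSupport ξ)
    (hξ_int : ∫ x, ξ x = 1)
    (F F' : Euc d → ℝ → ℝ)
    (hF_cont : Continuous fun p : Euc d × ℝ => F p.1 p.2)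
    (hF_deriv : ∀ (y : Euc d) (s : ℝ), HasDerivAt (fun r => F y r) (F' y s) s)
    (hF'_cont : Continuous fun p : Euc d × ℝ => F' p.1 p.2)
    (hF'_bdd : ∃ M, ∀ (y : Euc d) (s : ℝ), |F' y s| ≤ M)
    (μ μ' : Measure (Euc d)) [IsProbabilityMeasure μ] [IsProbabilityMeasure μ']
    (hμ_supp : ∃ K : Set (Euc d), IsCompact K ∧ μ Kᶜ = 0)
    (hμ'_supp : ∃ K : Set (Euc d), IsCompact K ∧ μ' Kᶜ = 0)
    (ε : ℝ) (hε : 0 < ε) (x : Euc d) :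
    FepsMeas d ξ ε F μ' x - FepsMeas d ξ ε F μ x
      = ∫ s in (0:ℝ)..1,
          ((∫ z, Kker d ξ ε F' μ μ' s x z ∂μ') - ∫ z, Kker d ξ ε F' μ μ' s x z ∂μ) := by
  obtain ⟨M, hM⟩ := hF'_bdd
  have hc := continuous_sMoll hξ_smooth.continuous ε
  have hcs := hasCompactSupport_sMoll hξ_supp hε.ne'
  obtain ⟨C, hC⟩ := hcs.exists_bound_of_continuous hc
  have hm := continuous_mollMeas hc hC μ
  have hm' := continuous_mollMeas hc hC μ'
  set m := mollMeas d ξ ε μ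
  set m' := mollMeas d ξ ε μ'
  have hC0 : 0 ≤ C := (norm_nonneg _).trans (hC 0)
  have bound (ν : Measure (Euc d)) [IsProbabilityMeasure ν] (y : Euc d) :
      ‖mollMeas d ξ ε ν y‖ ≤ C := by
    simpa [mollMeas] using norm_integral_le_of_norm_le_const (μ := ν)
      (.of_forall fun z => hC (y - z))
  set k : Euc d → ℝ := fun y => sMoll d ξ ε (x - y)
  have hk : Continuous k := by fun_prop
  have hks : HasCompactSupport k := hasCompactSupport_comp_sub_left hcs x
  have hki : Integrable k := hk.integrable_of_hasCompactSupport hks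
  have hF'_comp {X : Type} [TopologicalSpace X] {u : X → Euc d} {v : X → ℝ} (hu : Continuous u)
      (hv : Continuous v) : Continuous fun p => F' (u p) (v p) :=
    hF'_cont.comp (hu.prodMk hv)
  have hL (f : Euc d → ℝ) (hf : Continuous f) : Integrable fun y => k y * F y (f y) :=
    (hk.mul (hF_cont.comp (continuous_id.prodMk hf))).integrable_of_hasCompactSupport
      hks.mul_right
  have hinner (s : ℝ) (hs : s ∈ Set.uIcc (0 : ℝ) 1) :
      (∫ z, Kker d ξ ε F' μ μ' s x z ∂μ') - ∫ z, Kker d ξ ε F' μ μ' s x z ∂μ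
        = ∫ y, (m' y - m y) * F' y ((1 - s) * m y + s * m' y) * k y := by
    rw [Set.uIcc_of_le zero_le_one] at hs
    have hb : Continuous fun y => F' y ((1 - s) * m y + s * m' y) :=
      hF'_comp continuous_id (by fun_prop)
    have hi (ν : Measure (Euc d)) [IsProbabilityMeasure ν] :
        Integrable fun y => mollMeas d ξ ε ν y * F' y ((1 - s) * m y + s * m' y) * k y := by
      have := continuous_mollMeas hc hC ν
      exact (by fun_prop : Continuous fun y =>
        mollMeas d ξ ε ν y * F' y ((1 - s) * m y + s * m' y) * k y).integrable_of_hasCompactSupport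
          hks.mul_left
    simp only [Kker, mollMeas_interpMeas hc hC μ μ' hs.1 hs.2]
    erw [integral_mollifier_kernel hc hC μ' hb (fun y => hM _ _) hk hki,
      integral_mollifier_kernel hc hC μ hb (fun y => hM _ _) hk hki,
      ← integral_sub (hi μ') (hi μ)]
    simp only [sub_mul, m, m']
  rw [intervalIntegral.integral_congr hinner, intervalIntegral.integral_of_le zero_le_one,
    integral_integral_swap]
  · simp only [FepsMeas, ← intervalIntegral.integral_of_le (zero_le_one' ℝ)]
    rw [← integral_sub (hL m' hm') (hL m hm)]
    refine integral_congr_ae (.of_forall fun y => ?_)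
    simp only
    rw [intervalIntegral.integral_mul_const, integral_mul_deriv_segment (hF_deriv y)
      (hF'_comp continuous_const continuous_id)]
    ring
  · refine integrable_prod_of_norm_le_snd (g := fun y => (C + C) * M * ‖k y‖) ?_
      (hki.norm.const_mul _) fun p => ?_
    · have := hF'_comp (X := ℝ × Euc d) (v := fun p => (1 - p.1) * m p.2 + p.1 * m' p.2)
        continuous_snd (by fun_prop)
      unfold Function.uncurry
      fun_prop
    · simp only [Function.uncurry, norm_mul]
      have h1 := (norm_sub_le (m' p.2) (m p.2)).trans (add_le_add (bound μ' p.2) (bound μ p.2))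
      have h2 := hM p.2 ((1 - p.1) * m p.2 + p.1 * m' p.2)
      rw [← Real.norm_eq_abs] at h2
      gcongr
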